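/- arXiv:0801.4181 — 5 statements merged into one kernel-verified Lean document; each statement's English description precedes it below -/
import Mathlib

section
/- Let p be a prime and k a positive integer with p ≤ k. Then a_p(k) = e_p(k) + ⌊log_p k⌋. -/
/-- `e p k = ν_p(k!)`, the exponent of the prime `p` in `k!`. -/
def epow (p k : ℕ) : ℕ := padicValNat p (Nat.factorial k)

/-- The falling-factorial product `n (n-1) ⋯ (n-k+1)` over `ℤ`. -/
def fallingProd (k : ℕ) (n : ℤ) : ℤ := ∏ j ∈ Finset.range k, (n - (j : ℤ))

/-- `D p k n`: the predicate that `p^(2 e_p(k))` divides `n (n-1) ⋯ (n-k+1)` in `ℤ`. -/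
def Dpred (p k : ℕ) (n : ℤ) : Prop := ((p : ℤ)) ^ (2 * epow p k) ∣ fallingProd k n

/-- `aexp p k`: the least `m ≥ 0` such that `D p k n` depends only on the residue class of
`n` modulo `p^m`. -/
noncomputable def aexp (p k : ℕ) : ℕ :=
  sInf {m : ℕ | ∀ n n' : ℤ, n ≡ n' [ZMOD ((p : ℤ) ^ m)] → (Dpred p k n ↔ Dpred p k n')}

/-- valuation of `∏ (x + ε (i+1))` when `x` is highly divisible -/
lemma aux_prod (p : ℕ) (hp : p.Prime) (s a : ℕ) (x ε : ℤ) (hε : ε = 1 ∨ ε = -1)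
    (hx : (p : ℤ) ^ s ∣ x) (ha : ∀ i < a, ¬ p ^ s ∣ i + 1) :
    emultiplicity (p : ℤ) (∏ i ∈ Finset.range a, (x + ε * ((i : ℤ) + 1)))
      = (padicValNat p a.factorial : ℕ∞) := by
  have hpi : Prime (p : ℤ) := Nat.prime_iff_prime_int.mp hp
  have : Fact p.Prime := ⟨hp⟩
  rw [padicValNat_eq_emultiplicity (Nat.factorial_ne_zero a), ← Finset.prod_range_add_one_eq_factorial,
    Finset.emultiplicity_prod hpi, Finset.emultiplicity_prod hp.prime]
  refine Finset.sum_congr rfl fun i hi => ?_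
  have h1 : emultiplicity (p : ℤ) (ε * ((i : ℤ) + 1)) = emultiplicity p (i + 1) := by
    rw [← Int.natCast_emultiplicity]
    rcases hε with rfl | rfl
    · push_cast; rw [one_mul]
    · push_cast; rw [neg_one_mul, emultiplicity_neg]
  rw [← h1]
  apply emultiplicity_add_of_gt
  refine lt_of_lt_of_le ?_ (le_emultiplicity_of_pow_dvd hx)
  rw [h1]
  exact emultiplicity_lt_iff_not_dvd.mpr (ha i (Finset.mem_range.mp hi))

lemma aux_falling (a r : ℕ) (n : ℤ) :
    fallingProd (a + 1 + r) n = (∏ i ∈ Finset.range a, ((n - a) + 1 * ((i : ℤ) + 1))) * (n - a) *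
      ∏ i ∈ Finset.range r, ((n - a) + (-1) * ((i : ℤ) + 1)) := by
  unfold fallingProd
  rw [Finset.prod_range_add, Finset.prod_range_succ, ← Finset.prod_range_reflect]
  congr 1
  · congr 1
    refine Finset.prod_congr rfl fun i hi => ?_
    have := Finset.mem_range.mp hi
    have h : ((a - 1 - i : ℕ) : ℤ) = a - 1 - i := by omega
    rw [h]; ring
  · refine Finset.prod_congr rfl fun i hi => ?_
    push_cast; ring

lemma aux_core (p : ℕ) (hp : p.Prime) (s a r : ℕ) (n : ℤ)
    (hx : (p : ℤ) ^ s ∣ n - a) (ha : ∀ i < a, ¬ p ^ s ∣ i + 1) (hr : ∀ i < r, ¬ p ^ s ∣ i + 1) :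
    emultiplicity (p : ℤ) (fallingProd (a + 1 + r) n) = emultiplicity (p : ℤ) (n - a) +
      ((padicValNat p a.factorial + padicValNat p r.factorial : ℕ) : ℕ∞) := by
  have hpi : Prime (p : ℤ) := Nat.prime_iff_prime_int.mp hp
  rw [aux_falling, emultiplicity_mul hpi, emultiplicity_mul hpi,
    aux_prod p hp s a _ 1 (Or.inl rfl) hx ha, aux_prod p hp s r _ (-1) (Or.inr rfl) hx hr]
  push_cast
  ring

lemma aux_fact (p : ℕ) (hp : p.Prime) (a r : ℕ) :
    epow p (a + 1 + r) = padicValNat p a.factorial + padicValNat p r.factorial +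
      (padicValNat p (a + 1) + padicValNat p ((a + 1 + r).choose (a + 1))) := by
  have : Fact p.Prime := ⟨hp⟩
  unfold epow
  have h := Nat.choose_mul_factorial_mul_factorial (n := a + 1 + r) (k := a + 1) (by omega)
  rw [show a + 1 + r - (a + 1) = r by omega] at h
  have hc : (a + 1 + r).choose (a + 1) ≠ 0 := (Nat.choose_pos (by omega)).ne'
  rw [← h, padicValNat.mul (mul_ne_zero hc (Nat.factorial_ne_zero _)) (Nat.factorial_ne_zero _),
    padicValNat.mul hc (Nat.factorial_ne_zero _), Nat.factorial_succ,
    padicValNat.mul (by omega) (Nat.factorial_ne_zero _)]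
  ring

lemma aux_choose (p : ℕ) (hp : p.Prime) (b k : ℕ) (hb : b ≠ 0) (hbk : b ≤ k) :
    padicValNat p b + padicValNat p (k.choose b) ≤ Nat.log p k := by
  have : Fact p.Prime := ⟨hp⟩
  have h1 : padicValNat p b ≤ Nat.log p k :=
    (padicValNat_le_nat_log b).trans (Nat.log_mono_right hbk)
  rw [padicValNat_choose hbk (Nat.lt_succ_self _)]
  have : (Finset.Ico 1 (Nat.log p k).succ).filter
      (fun i => p ^ i ≤ b % p ^ i + (k - b) % p ^ i) ⊆
      Finset.Ioc (padicValNat p b) (Nat.log p k) := by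
    intro i hi
    rw [Finset.mem_filter, Finset.mem_Ico] at hi
    rw [Finset.mem_Ioc]
    refine ⟨?_, by omega⟩
    by_contra hlt
    have hd : p ^ i ∣ b := (padicValNat_dvd_iff_le hb).mpr (by omega)
    have h2 := hi.2
    rw [Nat.mod_eq_zero_of_dvd hd] at h2
    have := Nat.mod_lt (k - b) (pow_pos hp.pos i)
    omega
  have := Finset.card_le_card this
  rw [Nat.card_Ioc] at this
  omega

lemma aux_D (p k : ℕ) (n : ℤ) :
    Dpred p k n ↔ ((2 * epow p k : ℕ) : ℕ∞) ≤ emultiplicity (p : ℤ) (fallingProd k n) :=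
  pow_dvd_iff_le_emultiplicity

lemma aux_epow_pos (p k : ℕ) (hp : p.Prime) (hpk : p ≤ k) : 1 ≤ epow p k := by
  have : Fact p.Prime := ⟨hp⟩
  exact one_le_padicValNat_of_dvd (Nat.factorial_ne_zero _) (Nat.dvd_factorial hp.pos hpk)

lemma aux_high (p k : ℕ) (hp : p.Prime) (hpk : p ≤ k) (n : ℤ) (j : ℕ) (hj : j < k)
    (h : (p : ℤ) ^ (epow p k + Nat.log p k) ∣ n - j) : Dpred p k n := by
  have he := aux_epow_pos p k hp hpk
  obtain ⟨r, rfl⟩ : ∃ r, k = j + 1 + r := ⟨k - (j + 1), by omega⟩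
  have hbig : ∀ i, i + 1 < j + 1 + r →
      ¬ p ^ (epow p (j + 1 + r) + Nat.log p (j + 1 + r)) ∣ i + 1 := by
    intro i hi hd
    have h1 := Nat.le_of_dvd (by omega) hd
    have h2 := Nat.lt_pow_succ_log_self hp.one_lt (j + 1 + r)
    have h3 : p ^ (Nat.log p (j + 1 + r)).succ ≤
      p ^ (epow p (j + 1 + r) + Nat.log p (j + 1 + r)) := Nat.pow_le_pow_right hp.pos (by omega)
    omega
  rw [aux_D, aux_core p hp _ j r n h (fun i hi => hbig i (by omega)) (fun i hi => hbig i (by omega))]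
  have h4 := le_emultiplicity_of_pow_dvd h
  refine le_trans ?_ (add_le_add_left h4 _)
  have h5 := aux_fact p hp j r
  have h6 := aux_choose p hp (j + 1) (j + 1 + r) (by omega) (by omega)
  norm_cast
  omega

lemma aux_upper (p k : ℕ) (hp : p.Prime) (hpk : p ≤ k) (n n' : ℤ)
    (h : n ≡ n' [ZMOD ((p : ℤ) ^ (epow p k + Nat.log p k))]) : Dpred p k n ↔ Dpred p k n' := by
  have hpi : Prime (p : ℤ) := Nat.prime_iff_prime_int.mp hp
  have hd := h.dvd
  by_cases hex : ∃ j < k, (p : ℤ) ^ (epow p k + Nat.log p k) ∣ n - (j : ℤ)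
  · obtain ⟨j, hj, hjd⟩ := hex
    have hjd' : (p : ℤ) ^ (epow p k + Nat.log p k) ∣ n' - (j : ℤ) := by
      have := dvd_add hd hjd
      rwa [show n' - n + (n - j) = n' - (j : ℤ) by ring] at this
    exact ⟨fun _ => aux_high p k hp hpk n' j hj hjd', fun _ => aux_high p k hp hpk n j hj hjd⟩
  · push Not at hex
    rw [aux_D, aux_D]
    have : emultiplicity (p : ℤ) (fallingProd k n) = emultiplicity (p : ℤ) (fallingProd k n') := by
      unfold fallingProd
      rw [Finset.emultiplicity_prod hpi, Finset.emultiplicity_prod hpi]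
      refine Finset.sum_congr rfl fun j hj => ?_
      have h1 := emultiplicity_lt_iff_not_dvd.mpr (hex j (Finset.mem_range.mp hj))
      rw [show n' - (j : ℤ) = (n' - n) + (n - j) by ring]
      exact (emultiplicity_add_of_gt (h1.trans_le (le_emultiplicity_of_pow_dvd hd))).symm
    rw [this]

lemma aux_two (p k : ℕ) (hp : p.Prime) (hpk : 2 * p ≤ k) : 2 ≤ epow p k := by
  have : Fact p.Prime := ⟨hp⟩
  have h1 : p ^ 2 ∣ (p + p).factorial := by
    have h := Nat.factorial_mul_factorial_dvd_factorial_add p p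
    refine dvd_trans ?_ h
    rw [pow_two]
    exact mul_dvd_mul (Nat.dvd_factorial hp.pos le_rfl) (Nat.dvd_factorial hp.pos le_rfl)
  exact (padicValNat_dvd_iff_le (Nat.factorial_ne_zero _)).mp
    (h1.trans (Nat.factorial_dvd_factorial (by omega)))

lemma aux_lower (p k : ℕ) (hp : p.Prime) (hpk : p ≤ k) (m : ℕ)
    (hm : m < epow p k + Nat.log p k)
    (h : ∀ n n' : ℤ, n ≡ n' [ZMOD ((p : ℤ) ^ m)] → (Dpred p k n ↔ Dpred p k n')) : False := by
  have : Fact p.Prime := ⟨hp⟩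
  have hpi : Prime (p : ℤ) := Nat.prime_iff_prime_int.mp hp
  have he := aux_epow_pos p k hp hpk
  have hL : 1 ≤ Nat.log p k := Nat.log_pos hp.one_lt hpk
  have htwo := aux_two p k hp
  have hlk : p ^ Nat.log p k ≤ k := Nat.pow_log_le_self p (by have := hp.pos; omega)
  have hlk2 : k < p ^ (Nat.log p k + 1) := Nat.lt_pow_succ_log_self hp.one_lt k
  set L := Nat.log p k with hLdef
  obtain ⟨s, hs⟩ : ∃ s, epow p k + L = s + 1 := ⟨epow p k + L - 1, by omega⟩
  obtain ⟨a, ha⟩ : ∃ a, p ^ L = a + 1 := ⟨p ^ L - 1, by have := pow_pos hp.pos L; omega⟩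
  have hD : Dpred p k ((a : ℤ) + p ^ (s + 1)) :=
    aux_high p k hp hpk _ a (by omega) (by rw [← hLdef, hs]; simp)
  have hmod : (a : ℤ) + p ^ (s + 1) ≡ a + p ^ s [ZMOD (p : ℤ) ^ m] := by
    refine Int.ModEq.add_left _ ?_
    have h1 : (p : ℤ) ^ m ∣ p ^ s := pow_dvd_pow _ (by omega)
    have h2 : (p : ℤ) ^ m ∣ p ^ (s + 1) := pow_dvd_pow _ (by omega)
    exact (Int.modEq_zero_iff_dvd.mpr h2).trans (Int.modEq_zero_iff_dvd.mpr h1).symm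
  have hD' := (h _ _ hmod).mp hD
  obtain ⟨r, hr⟩ : ∃ r, k = a + 1 + r := ⟨k - (a + 1), by omega⟩
  have hLs : p ^ L ≤ p ^ s := Nat.pow_le_pow_right hp.pos (by omega)
  have hpL : p ≤ p ^ L := Nat.le_self_pow (by omega) p
  have key := aux_core p hp s a r ((a : ℤ) + p ^ s) (by simp)
    (fun i hi hd => by have := Nat.le_of_dvd (by omega) hd; omega)
    (fun i hi hd => by
      have h1 := Nat.le_of_dvd (by omega) hd
      have h2 := htwo (by omega)
      have h3 : p ^ (L + 1) ≤ p ^ s := Nat.pow_le_pow_right hp.pos (by omega)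
      omega)
  rw [aux_D, hr, key, add_sub_cancel_left, emultiplicity_pow_self_of_prime hpi] at hD'
  have h5 := aux_fact p hp a r
  have h6 : padicValNat p (a + 1) = L := by rw [← ha, padicValNat.prime_pow]
  rw [← hr] at hD' h5
  norm_cast at hD'
  omega

theorem stmt0 (p k : ℕ) (hp : p.Prime) (hk : 1 ≤ k) (hpk : p ≤ k) :
    aexp p k = epow p k + Nat.log p k := by
  unfold aexp
  refine le_antisymm (Nat.sInf_le fun n n' h => aux_upper p k hp hpk n n' h) ?_
  refine le_csInf ⟨_, fun n n' h => aux_upper p k hp hpk n n' h⟩ ?_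
  intro m hm
  by_contra hlt
  exact aux_lower p k hp hpk m (by omega) hm
end

section
/- There exists a constant C > 0 such that for all integers k ≥ 2, |log T(k) − k·log k| ≤ C·k, where T(k) = ∏_{p prime, p ≤ k} p^{a_p(k)}; that is, log T(k) = k log k + O(k). -/
/-- `Tmod k = ∏_{p prime, p ≤ k} p^(a_p(k))`, the minimum modulus. -/
noncomputable def Tmod (k : ℕ) : ℕ :=
  ∏ p ∈ (Finset.range (k + 1)).filter Nat.Prime, p ^ aexp p k

theorem emul_congr {p m : ℕ} {a b : ℤ} (h : (p : ℤ) ^ m ∣ a - b) (ha : ¬ (p : ℤ) ^ m ∣ a) :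
    emultiplicity (p : ℤ) a = emultiplicity (p : ℤ) b := by
  rw [emultiplicity_eq_emultiplicity_iff]
  have hb : ¬ (p : ℤ) ^ m ∣ b := fun hb => ha (by simpa using dvd_add h hb)
  intro t
  rcases le_total t m with ht | ht
  · have h2 : (p : ℤ) ^ t ∣ a - b := (pow_dvd_pow _ ht).trans h
    exact (dvd_iff_dvd_of_dvd_sub h2)
  · exact ⟨fun h3 => absurd ((pow_dvd_pow _ ht).trans h3) ha,
      fun h3 => absurd ((pow_dvd_pow _ ht).trans h3) hb⟩

theorem emul_fact {p : ℕ} (hp : p.Prime) (k : ℕ) :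
    emultiplicity (p : ℤ) ((k.factorial : ℕ) : ℤ) = epow p k := by
  have := Fact.mk hp
  rw [Int.natCast_emultiplicity, epow, padicValNat_eq_emultiplicity (Nat.factorial_ne_zero k)]

theorem fact_dvd_falling (k : ℕ) (n : ℤ) : (k.factorial : ℤ) ∣ fallingProd k n := by
  have h := Nat.factorial_coe_dvd_prod k (n - k + 1)
  rw [← Finset.prod_range_reflect] at h
  unfold fallingProd
  convert h using 2 with j hj
  have := Finset.mem_range.1 hj
  push_cast [Nat.sub_sub, Nat.cast_sub (show 1 + j ≤ k by omega)]
  ring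

theorem falling_split (i k : ℕ) (n : ℤ) :
    fallingProd (i + 1 + k) n = fallingProd i n * (n - i) * fallingProd k (n - i - 1) := by
  unfold fallingProd
  rw [Finset.prod_range_add, Finset.prod_range_succ]
  congr 1
  refine Finset.prod_congr rfl fun j _ => ?_
  push_cast; ring

theorem epow_split {p : ℕ} (hp : p.Prime) (i j : ℕ) :
    epow p (i + 1 + j) ≤ epow p i + epow p j + 2 * Nat.log p (i + 1 + j) := by
  have := Fact.mk hp
  have h1 : (i + 1 + j).factorial = (i + 1 + j) * ((i + j).choose j * (i.factorial * j.factorial)) := by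
    have := Nat.add_choose_mul_factorial_mul_factorial i j
    rw [← mul_assoc ((i+j).choose j), this, show i + 1 + j = (i + j) + 1 by ring, Nat.factorial_succ]
  have hc : (i + j).choose j ≠ 0 := (Nat.choose_pos (by omega)).ne'
  have hi := Nat.factorial_ne_zero i
  have hj := Nat.factorial_ne_zero j
  have h2 : padicValNat p ((i + j).choose j) ≤ Nat.log p (i + 1 + j) := by
    rw [← Nat.factorization_def _ hp]
    exact Nat.factorization_choose_le_log.trans (Nat.log_mono_right (by omega))
  have h3 : padicValNat p (i + 1 + j) ≤ Nat.log p (i + 1 + j) := padicValNat_le_nat_log _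
  unfold epow
  rw [h1, padicValNat.mul (by omega) (mul_ne_zero hc (mul_ne_zero hi hj)),
    padicValNat.mul hc (mul_ne_zero hi hj), padicValNat.mul hi hj]
  omega

theorem D_of_dvd {p k i : ℕ} (hp : p.Prime) (hi : i < k) {n : ℤ}
    (h : (p : ℤ) ^ (epow p k + 2 * Nat.log p k) ∣ n - i) : Dpred p k n := by
  obtain ⟨j, rfl⟩ := Nat.exists_eq_add_of_le (Nat.succ_le_of_lt hi)
  have hd : ∀ (k : ℕ) (n : ℤ), (p : ℤ) ^ epow p k ∣ fallingProd k n := fun k n =>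
    (pow_dvd_of_le_emultiplicity (emul_fact hp k).ge).trans (fact_dvd_falling k n)
  unfold Dpred
  simp only [Nat.succ_eq_add_one] at *
  rw [falling_split]
  refine dvd_trans ?_ (mul_dvd_mul (mul_dvd_mul (hd i n) h) (hd j _))
  rw [← pow_add, ← pow_add]
  have := epow_split hp i j
  exact pow_dvd_pow _ (by omega)

theorem mem_upper {p k : ℕ} (hp : p.Prime) : (epow p k + 2 * Nat.log p k) ∈
    {m : ℕ | ∀ n n' : ℤ, n ≡ n' [ZMOD ((p : ℤ) ^ m)] → (Dpred p k n ↔ Dpred p k n')} := by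
  intro n n' h
  have hd := h.symm.dvd
  by_cases hex : ∃ i < k, (p : ℤ) ^ (epow p k + 2 * Nat.log p k) ∣ n - i
  · obtain ⟨i, hi, h1⟩ := hex
    have h2 : (p : ℤ) ^ (epow p k + 2 * Nat.log p k) ∣ n' - i := by
      have := dvd_sub h1 hd
      simpa using this
    exact ⟨fun _ => D_of_dvd hp hi h2, fun _ => D_of_dvd hp hi h1⟩
  · push Not at hex
    unfold Dpred fallingProd
    rw [pow_dvd_iff_le_emultiplicity, pow_dvd_iff_le_emultiplicity,
      Finset.emultiplicity_prod (Nat.prime_iff_prime_int.1 hp),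
      Finset.emultiplicity_prod (Nat.prime_iff_prime_int.1 hp),
      Finset.sum_congr rfl fun (i : ℕ) hi => emul_congr (b := n' - (i : ℤ)) (by simpa using hd)
        (hex i (Finset.mem_range.1 hi))]

theorem aexp_le {p k : ℕ} (hp : p.Prime) : aexp p k ≤ epow p k + 2 * Nat.log p k :=
  Nat.sInf_le (mem_upper hp)

theorem not_D {p k m : ℕ} (hp : p.Prime) (hk : 0 < k) (hm : k ≤ p ^ m) (he : m < epow p k) :
    ¬ Dpred p k ((p : ℤ) ^ m) := by
  obtain ⟨k, rfl⟩ := Nat.exists_eq_succ_of_ne_zero hk.ne'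
  have hpz := Nat.prime_iff_prime_int.1 hp
  unfold Dpred fallingProd
  rw [pow_dvd_iff_le_emultiplicity, Nat.succ_eq_add_one, Finset.prod_range_succ',
    emultiplicity_mul hpz, Finset.emultiplicity_prod hpz]
  have h1 : ∀ j ∈ Finset.range k, emultiplicity (p : ℤ) ((p : ℤ) ^ m - ((j + 1 : ℕ) : ℤ))
      = emultiplicity (p : ℤ) ((j + 1 : ℕ) : ℤ) := by
    intro j hj
    have hj := Finset.mem_range.1 hj
    rw [← emultiplicity_neg]
    symm
    refine emul_congr (m := m) (by simp) ?_
    intro h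
    have h : p ^ m ∣ j + 1 := by exact_mod_cast h
    have := Nat.le_of_dvd (by omega) h
    omega
  rw [Finset.sum_congr rfl h1, ← Finset.emultiplicity_prod hpz, ← Nat.cast_prod,
    Finset.prod_range_add_one_eq_factorial, emul_fact hp]
  have h2 : emultiplicity (p : ℤ) ((p : ℤ) ^ m - ((0 : ℕ) : ℤ)) = m := by
    simpa using emultiplicity_pow_self_of_prime hpz m
  rw [h2]
  have h3 : epow p k ≤ epow p (k + 1) := by
    have := emul_fact hp k
    have h4 : emultiplicity (p : ℤ) ((k.factorial : ℕ) : ℤ)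
        ≤ emultiplicity (p : ℤ) (((k+1).factorial : ℕ) : ℤ) :=
      emultiplicity_le_emultiplicity_of_dvd_right
        (by exact_mod_cast Nat.factorial_dvd_factorial (Nat.le_succ k))
    rw [emul_fact hp, emul_fact hp] at h4
    exact_mod_cast h4
  simp only [Nat.succ_eq_add_one] at he
  intro h
  have h : 2 * epow p (k + 1) ≤ epow p k + m := by exact_mod_cast h
  omega

theorem le_aexp {p k : ℕ} (hp : p.Prime) (hpk : p ≤ k) :
    epow p k ≤ aexp p k + 2 * Nat.log p k := by
  have hL : 0 < Nat.log p k := Nat.log_pos hp.one_lt hpk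
  by_contra hcon
  have hmem := Nat.sInf_mem (s := {m : ℕ | ∀ n n' : ℤ, n ≡ n' [ZMOD ((p : ℤ) ^ m)] →
    (Dpred p k n ↔ Dpred p k n')}) ⟨_, mem_upper hp⟩
  change aexp p k ∈ _ at hmem
  have hk : 0 < k := hp.pos.trans_le hpk
  have hm : k ≤ p ^ (epow p k - 1) :=
    (Nat.lt_pow_succ_log_self hp.one_lt k).le.trans (Nat.pow_le_pow_right hp.pos (by omega))
  have hn := not_D hp hk hm (by omega)
  refine hn ((hmem _ 0 ?_).2 ?_)
  · exact (Int.modEq_zero_iff_dvd).2 (pow_dvd_pow _ (by omega))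
  · unfold Dpred fallingProd
    rw [Finset.prod_eq_zero (Finset.mem_range.2 hk) (by simp)]
    exact dvd_zero _

theorem log_fact_eq (k : ℕ) : Real.log (k.factorial : ℝ) =
    ∑ p ∈ (Finset.range (k + 1)).filter Nat.Prime, (epow p k : ℝ) * Real.log p := by
  have h : k.factorial = ∏ p ∈ (Finset.range (k + 1)).filter Nat.Prime, p ^ epow p k := by
    conv_lhs => rw [← Nat.prod_pow_prime_padicValNat k.factorial (Nat.factorial_ne_zero k) (k + 1 + k.factorial) (by omega)]
    symm
    apply Finset.prod_subset
    · intro p hp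
      simp only [Finset.mem_filter, Finset.mem_range] at hp ⊢
      exact ⟨by omega, hp.2⟩
    · intro p hp hp2
      simp only [Finset.mem_filter, Finset.mem_range] at hp hp2
      have : ¬ p ∣ k.factorial := by
        rw [hp.2.dvd_factorial]
        intro h
        exact hp2 ⟨by omega, hp.2⟩
      rw [epow, padicValNat.eq_zero_of_not_dvd this, pow_zero]
  conv_lhs => rw [h]
  push_cast
  rw [Real.log_prod]
  · simp
  · intro p hp
    have := (Finset.mem_filter.1 hp).2.pos
    positivity

theorem log_T_eq (k : ℕ) : Real.log (Tmod k : ℝ) =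
    ∑ p ∈ (Finset.range (k + 1)).filter Nat.Prime, (aexp p k : ℝ) * Real.log p := by
  unfold Tmod
  push_cast
  rw [Real.log_prod]
  · simp
  · intro p hp
    have := (Finset.mem_filter.1 hp).2.pos
    positivity

theorem stmt2 :
    ∃ C : ℝ, 0 < C ∧ ∀ k : ℕ, 2 ≤ k →
      |Real.log (Tmod k) - (k : ℝ) * Real.log k| ≤ C * k := by
  refine ⟨2 * (Real.log 4 + 4) + 1, by positivity, fun k hk => ?_⟩
  have hpsi := Chebyshev.psi_le_const_mul_self (x := (k : ℝ)) (by positivity)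
  rw [Chebyshev.psi_eq_sum_mul_log_prime] at hpsi
  have hset : Nat.primesLE k = (Finset.range (k + 1)).filter Nat.Prime := by
    ext p; simp [Nat.mem_primesLE, Nat.lt_succ_iff]
  rw [hset] at hpsi
  have h1 : |Real.log (Tmod k) - Real.log (k.factorial : ℝ)| ≤
      2 * ∑ p ∈ (Finset.range (k + 1)).filter Nat.Prime, (p.log k : ℝ) * Real.log p := by
    rw [log_T_eq, log_fact_eq, ← Finset.sum_sub_distrib, Finset.mul_sum]
    refine (Finset.abs_sum_le_sum_abs _ _).trans (Finset.sum_le_sum fun p hp => ?_)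
    simp only [Finset.mem_filter, Finset.mem_range] at hp
    have ha : (aexp p k : ℝ) ≤ epow p k + 2 * Nat.log p k := by exact_mod_cast aexp_le hp.2
    have hb : (epow p k : ℝ) ≤ aexp p k + 2 * Nat.log p k := by
      exact_mod_cast le_aexp hp.2 (by omega)
    have hl : 0 ≤ Real.log p := Real.log_natCast_nonneg p
    rw [← sub_mul, abs_mul, abs_of_nonneg hl, ← mul_assoc]
    refine mul_le_mul_of_nonneg_right ?_ hl
    rw [abs_le]; constructor <;> linarith
  have h2 : Real.log (k.factorial : ℝ) ≤ k * Real.log k := by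
    rw [← Real.log_pow]
    apply Real.log_le_log
    · exact_mod_cast Nat.factorial_pos k
    · exact_mod_cast Nat.factorial_le_pow k
  have h3 := Stirling.le_log_factorial_stirling (n := k) (by omega)
  have h4 : 0 ≤ Real.log k := Real.log_natCast_nonneg k
  have h5 : 0 ≤ Real.log (2 * Real.pi) := Real.log_nonneg (by linarith [Real.pi_gt_three])
  have hk0 : (0 : ℝ) ≤ k := by positivity
  rw [abs_le] at h1 ⊢
  constructor <;> nlinarith [h1.1, h1.2]
end

section
/- Let p be a prime and k a positive integer with p ≤ k. Then p^{a_p(k)} ≥ k. -/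
lemma fallingProd_self (k : ℕ) : fallingProd k (k : ℤ) = (k.factorial : ℤ) := by
  unfold fallingProd
  rw [← Nat.descFactorial_self, Nat.descFactorial_eq_prod_range, Nat.cast_prod]
  refine Finset.prod_congr rfl fun j hj => ?_
  rw [Nat.cast_sub (Finset.mem_range.mp hj).le]

lemma fallingProd_modEq (k : ℕ) (M n n' : ℤ) (h : n ≡ n' [ZMOD M]) :
    fallingProd k n ≡ fallingProd k n' [ZMOD M] := by
  unfold fallingProd
  induction k with
  | zero => simp
  | succ k ih =>
    rw [Finset.prod_range_succ, Finset.prod_range_succ]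
    exact ih.mul (h.sub_right _)

theorem stmt3 (p k : ℕ) (hp : p.Prime) (hk : 1 ≤ k) (hpk : p ≤ k) :
    k ≤ p ^ aexp p k := by
  have hmem : aexp p k ∈
      {m : ℕ | ∀ n n' : ℤ, n ≡ n' [ZMOD ((p : ℤ) ^ m)] → (Dpred p k n ↔ Dpred p k n')} := by
    refine Nat.sInf_mem ⟨2 * epow p k, fun n n' h => ?_⟩
    exact (fallingProd_modEq k _ n n' h).dvd_iff
  by_contra! hlt
  have hpos : 0 < p ^ aexp p k := pow_pos hp.pos _
  have h := hmem (k : ℤ) ((k - p ^ aexp p k : ℕ) : ℤ) (by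
    rw [Nat.cast_sub hlt.le]
    refine (Int.modEq_iff_dvd.mpr ?_)
    push_cast
    exact ⟨-1, by ring⟩)
  have h0 : Dpred p k ((k - p ^ aexp p k : ℕ) : ℤ) := by
    unfold Dpred fallingProd
    rw [Finset.prod_eq_zero (i := k - p ^ aexp p k) (Finset.mem_range.mpr (by omega)) (by simp)]
    exact dvd_zero _
  have h1 := h.mpr h0
  unfold Dpred at h1
  rw [fallingProd_self] at h1
  have h2 : p ^ (2 * epow p k) ∣ k.factorial := by exact_mod_cast h1
  haveI : Fact p.Prime := ⟨hp⟩
  have h3 := (padicValNat_dvd_iff_le k.factorial_ne_zero).mp h2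
  have h4 : 1 ≤ epow p k :=
    one_le_padicValNat_of_dvd k.factorial_ne_zero ((hp.dvd_factorial).mpr hpk)
  unfold epow at h3 h4
  omega
end

section
/- Let p be a prime and k an integer with p ≤ k. Then a_p(k) = 2e_p(k) − e_p(k−1) + max_{0 ≤ j ≤ k−1} ν_p(C(k−1, j)), where C(k−1,j) denotes the binomial coefficient. -/
/-- The valuation of `j! (k-1-j)!`. -/
def cval (p k j : ℕ) : ℕ := padicValNat p (Nat.factorial j * Nat.factorial (k - 1 - j))

lemma natAbs_prod_aux (s : Finset ℕ) (f : ℕ → ℤ) :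
    (∏ i ∈ s, f i).natAbs = ∏ i ∈ s, (f i).natAbs :=
  map_prod Int.natAbsHom f s

lemma erase_natAbs (k j : ℕ) (hj : j < k) :
    (∏ i ∈ (Finset.range k).erase j, ((j : ℤ) - (i : ℤ))).natAbs =
      Nat.factorial j * Nat.factorial (k - 1 - j) := by
  obtain ⟨r, rfl⟩ : ∃ r, k = j + 1 + r := ⟨k - (j + 1), by omega⟩
  have h1 : ∏ i ∈ (Finset.range (j + 1 + r)).erase j, ((j : ℤ) - (i : ℤ)) =
      ∏ i ∈ Finset.range (j + 1 + r), (if i = j then 1 else ((j : ℤ) - (i : ℤ))) := by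
    rw [← Finset.prod_erase (Finset.range (j + 1 + r)) (a := j)
      (f := fun i => (if i = j then 1 else ((j : ℤ) - (i : ℤ)))) (by simp)]
    apply Finset.prod_congr rfl
    intro i hi
    rw [if_neg (Finset.ne_of_mem_erase hi)]
  rw [h1, Finset.prod_range_add, Finset.prod_range_succ, if_pos rfl, mul_one, Int.natAbs_mul]
  have e : j + 1 + r - 1 - j = r := by omega
  rw [e]
  congr 1
  · rw [← Finset.prod_range_add_one_eq_factorial, ← Finset.prod_range_reflect, natAbs_prod_aux]
    apply Finset.prod_congr rfl
    intro i hi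
    have hi := Finset.mem_range.1 hi
    rw [if_neg (by omega)]
    omega
  · rw [← Finset.prod_range_add_one_eq_factorial, natAbs_prod_aux]
    apply Finset.prod_congr rfl
    intro i hi
    rw [if_neg (by omega)]
    push_cast
    omega

lemma emult_erase (p k j : ℕ) (hp : p.Prime) (hj : j < k) :
    emultiplicity (p : ℤ) (∏ i ∈ (Finset.range k).erase j, ((j : ℤ) - (i : ℤ))) = cval p k j := by
  have : Fact p.Prime := ⟨hp⟩
  rw [← Int.emultiplicity_natAbs, erase_natAbs k j hj, cval, padicValNat_eq_emultiplicity]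
  positivity

lemma emult_term_le (p k j i : ℕ) (hp : p.Prime) (hj : j < k)
    (hi : i ∈ (Finset.range k).erase j) :
    emultiplicity (p : ℤ) ((j : ℤ) - (i : ℤ)) ≤ cval p k j := by
  rw [← emult_erase p k j hp hj]
  exact emultiplicity_le_emultiplicity_of_dvd_right
    (Finset.dvd_prod_of_mem (fun i : ℕ => (j : ℤ) - (i : ℤ)) hi)

lemma emult_falling (p k j : ℕ) (n : ℤ) (hp : p.Prime) (hj : j < k) :
    emultiplicity (p : ℤ) (fallingProd k n) = emultiplicity (p : ℤ) (n - j) +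
      ∑ i ∈ (Finset.range k).erase j, emultiplicity (p : ℤ) (n - i) := by
  have hp' : Prime (p : ℤ) := Nat.prime_iff_prime_int.1 hp
  rw [fallingProd, Finset.emultiplicity_prod hp',
    Finset.add_sum_erase _ (fun i : ℕ => emultiplicity (p : ℤ) (n - (i : ℤ)))
      (Finset.mem_range.2 hj)]

lemma cval_add (p k j : ℕ) (hp : p.Prime) (hj : j < k) :
    epow p (k - 1) = cval p k j + padicValNat p ((k - 1).choose j) := by
  have : Fact p.Prime := ⟨hp⟩
  have h := Nat.choose_mul_factorial_mul_factorial (show j ≤ k - 1 by omega)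
  have hc : (k - 1).choose j ≠ 0 := (Nat.choose_pos (by omega)).ne'
  rw [epow, cval, ← h, mul_assoc, padicValNat.mul hc (by positivity)]
  ring

lemma epow_succ (p k : ℕ) (hp : p.Prime) (hk : 0 < k) :
    epow p k = padicValNat p k + epow p (k - 1) := by
  have : Fact p.Prime := ⟨hp⟩
  rw [epow, epow, ← Nat.mul_factorial_pred hk.ne', padicValNat.mul hk.ne' (by positivity)]

lemma one_le_val (p k : ℕ) (hp : p.Prime) (hpk : p ≤ k) :
    1 ≤ padicValNat p k + padicValNat p ((k - 1).choose (p - 1)) := by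
  have : Fact p.Prime := ⟨hp⟩
  have hp0 := hp.pos
  have h := Nat.add_one_mul_choose_eq (k - 1) (p - 1)
  rw [show k - 1 + 1 = k by omega, show p - 1 + 1 = p by omega] at h
  have hc : (k - 1).choose (p - 1) ≠ 0 := (Nat.choose_pos (by omega)).ne'
  rw [← padicValNat.mul (by omega) hc]
  apply one_le_padicValNat_of_dvd
  · exact mul_ne_zero (by omega) hc
  · rw [h]; exact dvd_mul_left _ _

lemma D_of_dvd_s6 (p k j A : ℕ) (n : ℤ) (hp : p.Prime) (hj : j < k)
    (h1 : cval p k j ≤ A) (h2 : 2 * epow p k ≤ A + cval p k j)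
    (h : (p : ℤ) ^ A ∣ n - j) : Dpred p k n := by
  have hp' : Prime (p : ℤ) := Nat.prime_iff_prime_int.1 hp
  rw [Dpred, pow_dvd_iff_le_emultiplicity, emult_falling p k j n hp hj]
  have hA := pow_dvd_iff_le_emultiplicity.1 h
  have hs : (cval p k j : ℕ∞) ≤
      ∑ i ∈ (Finset.range k).erase j, emultiplicity (p : ℤ) (n - i) := by
    rw [← emult_erase p k j hp hj, Finset.emultiplicity_prod hp']
    apply Finset.sum_le_sum
    intro i hi
    have hle : emultiplicity (p : ℤ) ((j : ℤ) - i) ≤ emultiplicity (p : ℤ) (n - j) :=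
      ((emult_term_le p k j i hp hj hi).trans (by exact_mod_cast h1)).trans hA
    have := min_le_emultiplicity_add (p := (p : ℤ)) (a := n - j) (b := (j : ℤ) - i)
    rw [min_eq_right hle] at this
    simpa using this
  refine le_trans ?_ (add_le_add hA hs)
  exact_mod_cast h2

lemma D_transfer (p k A : ℕ) (hp : p.Prime)
    (h1 : ∀ j < k, cval p k j ≤ A) (h2 : ∀ j < k, 2 * epow p k ≤ A + cval p k j)
    (n n' : ℤ) (h : n ≡ n' [ZMOD ((p : ℤ) ^ A)]) (hD : Dpred p k n) : Dpred p k n' := by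
  have hp' : Prime (p : ℤ) := Nat.prime_iff_prime_int.1 hp
  have hd : (p : ℤ) ^ A ∣ n' - n := h.dvd
  by_cases hx : ∃ j < k, (p : ℤ) ^ A ∣ n - j
  · obtain ⟨j, hj, hx⟩ := hx
    apply D_of_dvd_s6 p k j A n' hp hj (h1 j hj) (h2 j hj)
    have := dvd_add hd hx
    simpa using this
  · push Not at hx
    rw [Dpred, pow_dvd_iff_le_emultiplicity, fallingProd, Finset.emultiplicity_prod hp'] at hD ⊢
    refine hD.trans (Finset.sum_le_sum fun i hi => ?_)
    have hlt : emultiplicity (p : ℤ) (n - i) < A :=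
      emultiplicity_lt_iff_not_dvd.2 (hx i (Finset.mem_range.1 hi))
    have hle : emultiplicity (p : ℤ) (n - i) ≤ emultiplicity (p : ℤ) (n' - n) :=
      hlt.le.trans (pow_dvd_iff_le_emultiplicity.1 hd)
    have := min_le_emultiplicity_add (p := (p : ℤ)) (a := n' - n) (b := n - i)
    rw [min_eq_right hle] at this
    simpa using this

lemma not_D_s6 (p k j B : ℕ) (hp : p.Prime) (hj : j < k)
    (h1 : cval p k j < B) (h2 : B + cval p k j < 2 * epow p k) :
    ¬ Dpred p k ((j : ℤ) + (p : ℤ) ^ B) := by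
  have hp' : Prime (p : ℤ) := Nat.prime_iff_prime_int.1 hp
  rw [Dpred, pow_dvd_iff_le_emultiplicity, emult_falling p k j _ hp hj, not_le]
  have hB : emultiplicity (p : ℤ) ((p : ℤ) ^ B) = B :=
    emultiplicity_pow_self hp'.ne_zero hp'.not_isUnit B
  have hs : ∑ i ∈ (Finset.range k).erase j, emultiplicity (p : ℤ) ((j : ℤ) + (p : ℤ) ^ B - i) =
      cval p k j := by
    rw [← emult_erase p k j hp hj, Finset.emultiplicity_prod hp']
    apply Finset.sum_congr rfl
    intro i hi
    have hlt : emultiplicity (p : ℤ) ((j : ℤ) - i) < emultiplicity (p : ℤ) ((p : ℤ) ^ B) := by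
      rw [hB]
      exact (emult_term_le p k j i hp hj hi).trans_lt (by exact_mod_cast h1)
    rw [← emultiplicity_add_of_gt hlt]
    congr 1
    ring
  rw [hs, add_sub_cancel_left, hB]
  exact_mod_cast h2

theorem stmt6 (p k : ℕ) (hp : p.Prime) (hpk : p ≤ k) :
    (aexp p k : ℤ) =
      2 * (epow p k : ℤ) - (epow p (k - 1) : ℤ) +
        (((Finset.range k).sup fun j => padicValNat p ((k - 1).choose j) : ℕ) : ℤ) := by
  have hp0 := hp.pos
  have hk : 0 < k := by omega
  obtain ⟨j, hj, hS⟩ := Finset.exists_mem_eq_sup (Finset.range k) ⟨0, by simpa using hk⟩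
    (fun j => padicValNat p ((k - 1).choose j))
  have hmax : ∀ i < k, padicValNat p ((k - 1).choose i) ≤
      (Finset.range k).sup fun j => padicValNat p ((k - 1).choose j) := fun i hi =>
    Finset.le_sup (f := fun j => padicValNat p ((k - 1).choose j)) (Finset.mem_range.2 hi)
  generalize ((Finset.range k).sup fun j => padicValNat p ((k - 1).choose j)) = S at *
  have hj := Finset.mem_range.1 hj
  have hsucc := epow_succ p k hp hk
  have hone := one_le_val p k hp hpk
  have hcj := cval_add p k j hp hj
  have hm1 := hmax (p - 1) (by omega)
  obtain ⟨A, hA⟩ : ∃ A, A = 2 * epow p k - epow p (k - 1) + S := ⟨_, rfl⟩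
  have key : aexp p k = A := by
    refine IsLeast.csInf_eq ⟨?_, ?_⟩
    · have h1 : ∀ i < k, cval p k i ≤ A := fun i hi => by
        have := cval_add p k i hp hi
        omega
      have h2 : ∀ i < k, 2 * epow p k ≤ A + cval p k i := fun i hi => by
        have := cval_add p k i hp hi
        have := hmax i hi
        omega
      exact fun n n' h => ⟨D_transfer p k A hp h1 h2 n n' h, D_transfer p k A hp h1 h2 n' n h.symm⟩
    · intro m hm
      by_contra hlt
      push Not at hlt
      have hmod : (j : ℤ) ≡ (j : ℤ) + (p : ℤ) ^ (A - 1) [ZMOD ((p : ℤ) ^ m)] := by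
        rw [Int.modEq_iff_dvd, add_sub_cancel_left]
        exact pow_dvd_pow _ (by omega)
      refine not_D_s6 p k j (A - 1) hp hj (by omega) (by omega) ((hm _ _ hmod).1 ?_)
      rw [Dpred, fallingProd, Finset.prod_eq_zero (Finset.mem_range.2 hj) (sub_self _)]
      exact dvd_zero _
  rw [key]
  omega
end

section
/- Let σ be a permutation of m symbols that is k-inflatable, i.e., σ ⊗ ρ_n is asymptotically k-symmetric (where ρ_n is a uniformly random permutation of n symbols and convergence is in probability as n → ∞). Then for every τ ∈ S_k, m^k/(k!)² = Σ_{t=1}^{k} Σ_{π ∈ Π^τ_t} X^{τ/π}(σ) · ∏_{J ∈ π} (|J|!)^{−2}. -/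
/-- `patternCount σ τ`: the number of occurrences of the pattern `τ ∈ S_k` in `σ ∈ S_n`,
i.e. the number of strictly increasing `f : Fin k → Fin n` such that `σ ∘ f` has order
type `τ`. -/
def patternCount {n k : ℕ} (σ : Equiv.Perm (Fin n)) (τ : Equiv.Perm (Fin k)) : ℕ :=
  (Finset.univ.filter fun f : Fin k → Fin n =>
    (∀ a b : Fin k, a < b → f a < f b) ∧
    (∀ a b : Fin k, τ a < τ b ↔ σ (f a) < σ (f b))).card

/-- The tensor (Kronecker) product of permutations: for `σ ∈ S_a`, `ρ ∈ S_b`,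
`(σ ⊗ ρ)(j) = b·σ(⌊j/b⌋) + ρ(j mod b)` on `{0, …, ab−1}`. -/
def tensorPerm {a b : ℕ} (σ : Equiv.Perm (Fin a)) (ρ : Equiv.Perm (Fin b)) :
    Equiv.Perm (Fin (a * b)) :=
  (finProdFinEquiv.symm.trans (σ.prodCongr ρ)).trans finProdFinEquiv

open scoped Classical in
/-- `σ ∈ S_m` is `k`-inflatable: `σ ⊗ ρ_n` (with `ρ_n` a uniformly random permutation of
`n` symbols) is asymptotically `k`-symmetric, i.e. the sizes `m·n` tend to infinity and,
for every pattern `τ ∈ S_k`, `k!² · X^τ(σ ⊗ ρ_n) / (mn)^k → 1` in probability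
(the probability is the proportion of permutations `ρ ∈ S_n` violating the
`ε`-approximation, which must tend to `0`). -/
noncomputable def IsKInflatable {m : ℕ} (σ : Equiv.Perm (Fin m)) (k : ℕ) : Prop :=
  Filter.Tendsto (fun n : ℕ => m * n) Filter.atTop Filter.atTop ∧
  ∀ τ : Equiv.Perm (Fin k), ∀ ε : ℝ, 0 < ε →
    Filter.Tendsto (fun n : ℕ =>
      ((Finset.univ.filter fun ρ : Equiv.Perm (Fin n) =>
          ε < |(Nat.factorial k : ℝ) ^ 2 * (patternCount (tensorPerm σ ρ) τ : ℝ) /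
              ((m * n : ℕ) : ℝ) ^ k - 1|).card : ℝ) /
        (Fintype.card (Equiv.Perm (Fin n)) : ℝ))
      Filter.atTop (nhds 0)

/-- The rank function of `g : Fin t → ℕ`: `j ↦ #{i | g i < g j}`. -/
def rankFun {t : ℕ} (g : Fin t → ℕ) : Fin t → Fin t := fun j =>
  ⟨(Finset.univ.filter fun i => g i < g j).card, by
    have h1 : (Finset.univ.filter fun i => g i < g j) ⊆ Finset.univ.erase j := by
      intro i hi
      rcases Finset.mem_filter.mp hi with ⟨-, hlt⟩
      exact Finset.mem_erase.mpr ⟨by rintro rfl; exact lt_irrefl _ hlt, Finset.mem_univ i⟩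
    calc (Finset.univ.filter fun i => g i < g j).card
        ≤ (Finset.univ.erase j).card := Finset.card_le_card h1
      _ < Finset.univ.card := Finset.card_erase_lt_of_mem (Finset.mem_univ j)
      _ = t := by simp⟩

open scoped Classical in
/-- The permutation of `Fin t` induced by the order type of an injective `g : Fin t → ℕ`
(junk value `1` if `g` is not injective). -/
noncomputable def rankPerm {t : ℕ} (g : Fin t → ℕ) : Equiv.Perm (Fin t) :=
  if h : Function.Injective g then
    Equiv.ofBijective (rankFun g) (by
      rw [Fintype.bijective_iff_injective_and_card]
      refine ⟨fun i j hij => ?_, rfl⟩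
      by_contra hne
      have key : ∀ i j : Fin t, g i < g j →
          (Finset.univ.filter fun i' => g i' < g i).card <
            (Finset.univ.filter fun i' => g i' < g j).card := by
        intro i j hlt
        apply Finset.card_lt_card
        refine ⟨fun x hx => ?_, fun hsub => ?_⟩
        · rcases Finset.mem_filter.mp hx with ⟨-, h2⟩
          exact Finset.mem_filter.mpr ⟨Finset.mem_univ x, lt_trans h2 hlt⟩
        · have := hsub (Finset.mem_filter.mpr ⟨Finset.mem_univ i, hlt⟩)
          exact lt_irrefl _ (Finset.mem_filter.mp this).2
      have hv : ((rankFun g i : Fin t) : ℕ) = ((rankFun g j : Fin t) : ℕ) :=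
        congrArg Fin.val hij
      rcases lt_trichotomy (g i) (g j) with h1 | h1 | h1
      · exact absurd hv (Nat.ne_of_lt (key i j h1))
      · exact hne (h h1)
      · exact absurd hv.symm (Nat.ne_of_lt (key j i h1)))
  else Equiv.refl _

/-- The contraction `τ / π` of `τ ∈ S_k` along a partition of `[k]` into `t` intervals,
where the partition is encoded by the map `c` sending each point to the index of its
block: the order type induced by `τ` on the blocks (via the representatives of least
`τ`-value in each block). -/
noncomputable def contract {k t : ℕ} (τ : Equiv.Perm (Fin k)) (c : Fin k → Fin t) :
    Equiv.Perm (Fin t) :=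
  rankPerm fun j => sInf {x : ℕ | ∃ i, c i = j ∧ (τ i : ℕ) = x}

/-- `c : Fin k → Fin t` encodes a partition of `[k]` into `t` intervals
`J_1 < ⋯ < J_t` (the fibers of the monotone surjection `c`) which is consistent with
`τ`, i.e. each image `τ(J_j)` is also an interval. -/
def IsIntervalPartition {k t : ℕ} (τ : Equiv.Perm (Fin k)) (c : Fin k → Fin t) : Prop :=
  (∀ a b : Fin k, a ≤ b → c a ≤ c b) ∧
  (∀ j : Fin t, ∃ i, c i = j) ∧
  (∀ a b v : Fin k, c a = c b → τ a ≤ v → v ≤ τ b → ∃ i, c i = c a ∧ τ i = v)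

namespace Infl

open Finset

/-- `(u, h)` has lexicographic order type `τ` (one direction; the other follows by totality). -/
def LexOrd {k m n : ℕ} (τ : Equiv.Perm (Fin k)) (u : Fin k → Fin m) (h : Fin k → Fin n) : Prop :=
  ∀ a b, τ a < τ b → (u a < u b ∨ u a = u b ∧ h a < h b)

/-- weight of a map -/
noncomputable def fibProd {k m : ℕ} (u : Fin k → Fin m) : ℕ :=
  ∏ j, Nat.factorial (univ.filter fun i => u i = j).card

lemma fibProd_pos {k m : ℕ} (u : Fin k → Fin m) : 0 < fibProd u :=
  Finset.prod_pos fun _ _ => Nat.factorial_pos _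

open scoped Classical in
lemma count_one {k m n : ℕ} (u : Fin k → Fin m) (hu : Monotone u) :
    (univ.filter fun e : Fin k ↪ Fin n => LexOrd 1 u e).card * fibProd u = n.descFactorial k := by
  have h1 : fibProd u = Fintype.card {g : Equiv.Perm (Fin k) // u ∘ g = u} := by
    rw [DomMulAct.stabilizer_card]
    unfold fibProd
    refine Finset.prod_congr rfl fun j _ => ?_
    rw [Fintype.card_subtype]
  have h2 : n.descFactorial k = Fintype.card (Fin k ↪ Fin n) := by
    rw [Fintype.card_embedding_eq]; simp
  rw [h1, h2, ← Fintype.card_subtype, ← Fintype.card_prod]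
  have key : ∀ (e : Fin k ↪ Fin n), Function.Injective (fun a => toLex (u a, e a)) := by
    intro e a b hab
    have := congrArg (fun x => (ofLex x).2) hab
    exact e.injective this
  apply Fintype.card_of_bijective
    (f := fun p : {e : Fin k ↪ Fin n // LexOrd 1 u e} × {g : Equiv.Perm (Fin k) // u ∘ g = u} =>
      p.2.1.toEmbedding.trans p.1.1)
  constructor
  · rintro ⟨⟨e, he⟩, ⟨s, hs⟩⟩ ⟨⟨e', he'⟩, ⟨s', hs'⟩⟩ hh
    simp only at hh
    have srt : ∀ (e : Fin k ↪ Fin n) (s : Equiv.Perm (Fin k)), LexOrd 1 u e → u ∘ s = u →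
        s⁻¹ = Tuple.sort (fun a => toLex (u a, s.toEmbedding.trans e a)) := by
      intro e s he hs
      rw [Tuple.eq_sort_iff]
      constructor
      · have : ((fun a => toLex (u a, s.toEmbedding.trans e a)) ∘ ⇑s⁻¹)
            = fun a => toLex (u a, e a) := by
          funext a
          have : u (s⁻¹ a) = u a := by
            have := congrFun hs (s⁻¹ a)
            simpa using this.symm
          simp only [Function.comp, Function.Embedding.trans_apply, Equiv.coe_toEmbedding, this]
          simp
        rw [this]
        have : StrictMono fun a => toLex (u a, e a) := by
          intro a b hab
          rw [Prod.Lex.toLex_lt_toLex]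
          exact he a b hab
        exact this.monotone
      · intro i j hij hf
        have := key _ hf
        exact absurd (s⁻¹.injective this) hij.ne
    have e1 := srt e s he hs
    have e2 := srt e' s' he' hs'
    rw [hh, ← e2] at e1
    have e3 : s = s' := inv_injective e1
    subst e3
    have : e = e' := by
      ext a
      have := congrArg (fun f : Fin k ↪ Fin n => f (s⁻¹ a)) hh
      simpa using congrArg Fin.val this
    subst this
    rfl
  · intro e
    set p := Tuple.sort (fun a => toLex (u a, e a)) with hp
    have hm : Monotone ((fun a => toLex (u a, e a)) ∘ p) := Tuple.monotone_sort _
    have hm1 : Monotone (u ∘ p) := fun a b hab => Prod.Lex.monotone_fst _ _ (hm hab)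
    have hup : u ∘ p = u := by
      have := Tuple.unique_monotone (f := u) (σ := p) (τ := 1) hm1 (by simpa using hu)
      simpa using this
    refine ⟨⟨⟨p.toEmbedding.trans e, ?_⟩, ⟨p⁻¹, ?_⟩⟩, ?_⟩
    · intro a b hab
      have := (hm.strictMono_of_injective ((key e).comp p.injective)) hab
      simp only [Function.comp] at this
      rw [Prod.Lex.toLex_lt_toLex] at this
      have h3 : ∀ a, u (p a) = u a := congrFun hup
      simpa [h3] using this
    · funext a
      have := congrFun hup (p⁻¹ a)
      simpa using this.symm
    · ext a
      simp

open scoped Classical in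
lemma count_perm {k m n : ℕ} (τ : Equiv.Perm (Fin k)) (u : Fin k → Fin m) :
    (univ.filter fun e : Fin k ↪ Fin n => LexOrd τ u e).card * fibProd u
      = if (∀ a b, τ a ≤ τ b → u a ≤ u b) then n.descFactorial k else 0 := by
  split_ifs with hu
  · have h0 : Monotone (u ∘ ⇑τ⁻¹) := by
      intro a b hab
      apply hu
      simpa using hab
    rw [← count_one (n := n) _ h0]
    congr 1
    · refine Finset.card_bij (fun e _ => (τ⁻¹).toEmbedding.trans e) ?_ ?_ ?_
      · intro e he
        simp only [mem_filter, mem_univ, true_and] at he ⊢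
        intro a b hab
        exact he (τ⁻¹ a) (τ⁻¹ b) (by simpa using hab)
      · intro e _ e' _ hee
        ext a
        have := congrArg (fun f : Fin k ↪ Fin n => f (τ a)) hee
        simpa using congrArg Fin.val this
      · intro e he
        simp only [mem_filter, mem_univ, true_and] at he
        refine ⟨τ.toEmbedding.trans e, ?_, ?_⟩
        · simp only [mem_filter, mem_univ, true_and]
          intro a b hab
          simpa using he (τ a) (τ b) (by simpa using hab)
        · ext a; simp
    · unfold fibProd
      refine Finset.prod_congr rfl fun j _ => ?_
      congr 1
      refine Finset.card_bij (fun i _ => τ i) ?_ ?_ ?_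
      · intro a; simp
      · intro a _ b _; simp
      · intro b hb
        exact ⟨τ⁻¹ b, by simpa using hb, by simp⟩
  · rw [Finset.card_eq_zero.mpr, zero_mul]
    rw [Finset.filter_eq_empty_iff]
    intro e _ he
    apply hu
    intro a b hab
    rcases hab.eq_or_lt with h | h
    · rw [τ.injective h]
    · rcases he a b h with h | h
      · exact h.le
      · exact h.1.le

lemma fibProd_perm {k m : ℕ} (σ : Equiv.Perm (Fin m)) (u : Fin k → Fin m) :
    fibProd (fun a => σ (u a)) = fibProd u := by
  unfold fibProd
  rw [← Equiv.prod_comp σ]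
  simp

open scoped Classical in
lemma count_indep {k n : ℕ} (P : (Fin k ↪ Fin n) → Prop) (h h' : Fin k ↪ Fin n) :
    (univ.filter fun ρ : Equiv.Perm (Fin n) => P (h.trans ρ.toEmbedding)).card
      = (univ.filter fun ρ : Equiv.Perm (Fin n) => P (h'.trans ρ.toEmbedding)).card := by
  obtain ⟨g, hg⟩ : ∃ g : Equiv.Perm (Fin n), ∀ a, g (h a) = h' a := by
    have := (Equiv.Perm.isMultiplyPretransitive (Fin n) k).exists_smul_eq h h'
    obtain ⟨g, hg⟩ := this
    exact ⟨g, fun a => by rw [← hg]; rfl⟩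
  have hE : ∀ ρ : Equiv.Perm (Fin n),
      h.trans (ρ * g).toEmbedding = h'.trans ρ.toEmbedding := by
    intro ρ; ext a; simp [hg]
  symm
  refine Finset.card_bij (fun ρ _ => ρ * g) ?_ ?_ ?_
  · intro ρ hρ
    simp only [mem_filter, mem_univ, true_and] at hρ ⊢
    rwa [hE]
  · intro a _ b _ hab
    exact mul_right_cancel hab
  · intro ρ hρ
    simp only [mem_filter, mem_univ, true_and] at hρ
    refine ⟨ρ * g⁻¹, ?_, by simp⟩
    simp only [mem_filter, mem_univ, true_and]
    rw [← hE]; simpa using hρ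

open scoped Classical in
lemma sum_perm {k n : ℕ} (A B : (Fin k ↪ Fin n) → Prop) :
    (∑ ρ : Equiv.Perm (Fin n),
      (univ.filter fun e : Fin k ↪ Fin n => A e ∧ B (e.trans ρ.toEmbedding)).card)
      * n.descFactorial k = n.factorial * ((univ.filter A).card * (univ.filter B).card) := by
  have h2 : n.descFactorial k = Fintype.card (Fin k ↪ Fin n) := by
    rw [Fintype.card_embedding_eq]; simp
  set N : (Fin k ↪ Fin n) → ℕ := fun e =>
    (univ.filter fun ρ : Equiv.Perm (Fin n) => B (e.trans ρ.toEmbedding)).card with hN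
  have hNc : ∀ e e', N e = N e' := fun e e' => count_indep B e e'
  have hNs : ∀ e, n.descFactorial k * N e = n.factorial * (univ.filter B).card := by
    intro e
    have : ∑ e' : Fin k ↪ Fin n, N e' = n.descFactorial k * N e := by
      rw [Finset.sum_congr rfl (fun e' _ => hNc e' e), h2]; simp
    rw [← this]
    simp only [hN, Finset.card_filter]
    rw [Finset.sum_comm]
    have : ∀ ρ : Equiv.Perm (Fin n), (∑ e : Fin k ↪ Fin n,
        if B (e.trans ρ.toEmbedding) then 1 else 0) = ∑ e : Fin k ↪ Fin n, if B e then 1 else 0 := by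
      intro ρ
      refine Fintype.sum_bijective (fun e : Fin k ↪ Fin n => e.trans ρ.toEmbedding) ?_ _ _
        (fun _ => rfl)
      constructor
      · intro e e' hee
        ext a
        have := congrArg (fun f : Fin k ↪ Fin n => ρ⁻¹ (f a)) hee
        simpa using congrArg Fin.val this
      · intro e
        exact ⟨e.trans (ρ⁻¹).toEmbedding, by ext a; simp⟩
    rw [Finset.sum_congr rfl (fun ρ _ => this ρ)]
    simp [Fintype.card_perm]
  have h3 : (∑ ρ : Equiv.Perm (Fin n),
      (univ.filter fun e : Fin k ↪ Fin n => A e ∧ B (e.trans ρ.toEmbedding)).card)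
      = ∑ e ∈ univ.filter A, N e := by
    simp only [hN, Finset.card_filter]
    rw [Finset.sum_comm, Finset.sum_filter]
    refine Finset.sum_congr rfl fun e _ => ?_
    by_cases hA : A e <;> simp [hA]
  rw [h3, Finset.sum_mul]
  rw [Finset.sum_congr rfl (fun e _ => (mul_comm _ _).trans (hNs e))]
  simp; ring

lemma fpf_lt {m n : ℕ} (p q : Fin m × Fin n) :
    finProdFinEquiv p < finProdFinEquiv q ↔ (p.1 < q.1 ∨ p.1 = q.1 ∧ p.2 < q.2) := by
  obtain ⟨⟨a, ha⟩, ⟨b, hb⟩⟩ := p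
  obtain ⟨⟨c, hc⟩, ⟨d, hd⟩⟩ := q
  simp only [finProdFinEquiv, Equiv.coe_fn_mk, Fin.mk_lt_mk, Fin.mk.injEq]
  rcases lt_trichotomy a c with h | h | h
  · have : n * (a + 1) ≤ n * c := Nat.mul_le_mul_left _ h
    constructor
    · intro _; exact Or.inl h
    · intro _; rw [mul_add] at this; omega
  · subst h; simp
  · have : n * (c + 1) ≤ n * a := Nat.mul_le_mul_left _ h
    rw [mul_add] at this
    constructor
    · intro _; omega
    · intro _; omega

lemma lexOrd_iff {k m n : ℕ} (τ : Equiv.Perm (Fin k)) (u : Fin k → Fin m) (h : Fin k → Fin n) :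
    LexOrd τ u h ↔ ∀ a b, τ a < τ b ↔ (u a < u b ∨ u a = u b ∧ h a < h b) := by
  constructor
  · intro H a b
    refine ⟨H a b, fun hl => ?_⟩
    rcases lt_trichotomy (τ a) (τ b) with h1 | h1 | h1
    · exact h1
    · have := τ.injective h1
      subst this
      simp at hl
    · have h2 := H b a h1
      exfalso
      rcases hl with hl | hl <;> rcases h2 with h2 | h2
      · exact lt_asymm hl h2
      · exact hl.ne' h2.1
      · exact h2.ne' hl.1
      · exact lt_asymm hl.2 h2.2
  · intro H a b hab
    exact (H a b).1 hab

open scoped Classical in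
lemma pc_eq {k m n : ℕ} (σ : Equiv.Perm (Fin m)) (ρ : Equiv.Perm (Fin n)) (τ : Equiv.Perm (Fin k)) :
    patternCount (tensorPerm σ ρ) τ = ∑ g : Fin k → Fin m,
      (univ.filter fun h : Fin k → Fin n =>
        LexOrd 1 g h ∧ LexOrd τ (fun a => σ (g a)) (fun a => ρ (h a))).card := by
  simp only [Finset.card_filter]
  rw [← Fintype.sum_prod_type' (f := fun (g : Fin k → Fin m) (h : Fin k → Fin n) =>
    if LexOrd 1 g h ∧ LexOrd τ (fun a => σ (g a)) (fun a => ρ (h a)) then 1 else 0)]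
  rw [← Finset.card_filter]
  unfold patternCount
  symm
  refine Finset.card_bij (fun p _ a => finProdFinEquiv (p.1 a, p.2 a)) ?_ ?_ ?_
  · rintro ⟨g, h⟩ hp
    simp only [mem_filter, mem_univ, true_and] at hp ⊢
    refine ⟨fun a b hab => ?_, fun a b => ?_⟩
    · rw [fpf_lt]; exact hp.1 a b hab
    · rw [(lexOrd_iff _ _ _).1 hp.2 a b]
      simp only [tensorPerm, Equiv.trans_apply, Equiv.symm_apply_apply, fpf_lt]
      rfl
  · rintro ⟨g, h⟩ _ ⟨g', h'⟩ _ hh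
    have := fun a => finProdFinEquiv.injective (congrFun hh a)
    simp only [Prod.mk.injEq] at this
    exact Prod.ext (funext fun a => (this a).1) (funext fun a => (this a).2)
  · intro f hf
    simp only [mem_filter, mem_univ, true_and] at hf
    refine ⟨(fun a => (finProdFinEquiv.symm (f a)).1, fun a => (finProdFinEquiv.symm (f a)).2), ?_, ?_⟩
    · simp only [mem_filter, mem_univ, true_and]
      constructor
      · intro a b hab
        have := hf.1 a b hab
        rw [← finProdFinEquiv.apply_symm_apply (f a), ← finProdFinEquiv.apply_symm_apply (f b),
          fpf_lt] at this
        exact this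
      · intro a b hab
        have := (hf.2 a b).1 hab
        simp only [tensorPerm, Equiv.trans_apply, fpf_lt] at this
        exact this
    · funext a
      exact finProdFinEquiv.apply_symm_apply (f a)

open scoped Classical in
lemma emb_bounds {k n : ℕ} (P : (Fin k → Fin n) → Prop) :
    (univ.filter fun e : Fin k ↪ Fin n => P e).card ≤ (univ.filter P).card ∧
    (univ.filter P).card + n.descFactorial k
      ≤ (univ.filter fun e : Fin k ↪ Fin n => P e).card + n ^ k := by
  have h2 : n.descFactorial k = Fintype.card (Fin k ↪ Fin n) := by
    rw [Fintype.card_embedding_eq]; simp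
  have h4 : ∀ Q : (Fin k → Fin n) → Prop, (univ.filter fun e : Fin k ↪ Fin n => Q e).card
      = (univ.filter fun f => Function.Injective f ∧ Q f).card := by
    intro Q
    refine Finset.card_bij (fun e _ => e) ?_ ?_ ?_
    · intro e he
      simp only [mem_filter, mem_univ, true_and] at he ⊢
      exact ⟨e.injective, he⟩
    · intro a _ b _ h; exact DFunLike.coe_injective h
    · intro f hf
      simp only [mem_filter, mem_univ, true_and] at hf
      exact ⟨⟨f, hf.1⟩, by simpa using hf.2, rfl⟩
  have h5 := h4 (fun _ => True)
  have h3 : n ^ k = (univ : Finset (Fin k → Fin n)).card := by simp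
  simp only [filter_true, and_true] at h5
  rw [Finset.card_univ, ← h2] at h5
  constructor
  · rw [h4]
    apply Finset.card_le_card
    intro f; simp only [mem_filter, mem_univ, true_and]; exact fun h => h.2
  · rw [h4, h5, h3, ← Finset.card_union_add_card_inter, Finset.filter_union_right,
      ← Finset.filter_and]
    rw [add_comm]
    apply add_le_add
    · apply Finset.card_le_card
      intro f; simp only [mem_filter, mem_univ, true_and]; tauto
    · apply Finset.card_le_card; simp

/-- maps compatible with `σ` and `τ` -/
def Good {k m : ℕ} (σ : Equiv.Perm (Fin m)) (τ : Equiv.Perm (Fin k)) (g : Fin k → Fin m) : Prop :=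
  (∀ a b, a ≤ b → g a ≤ g b) ∧ (∀ a b, τ a ≤ τ b → σ (g a) ≤ σ (g b))

open scoped Classical in
/-- the limit -/
noncomputable def limS {k m : ℕ} (σ : Equiv.Perm (Fin m)) (τ : Equiv.Perm (Fin k)) : ℝ :=
  ∑ g ∈ univ.filter (Good σ τ), ((fibProd g : ℝ)⁻¹) ^ 2

open scoped Classical in
lemma sum_emb {k m n : ℕ} (hn : k ≤ n) (σ : Equiv.Perm (Fin m)) (τ : Equiv.Perm (Fin k))
    (g : Fin k → Fin m) :
    ((∑ ρ : Equiv.Perm (Fin n), (univ.filter fun e : Fin k ↪ Fin n =>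
        LexOrd 1 g e ∧ LexOrd τ (fun a => σ (g a)) (fun a => ρ (e a))).card : ℕ) : ℝ)
      = n.factorial * n.descFactorial k * (if Good σ τ g then ((fibProd g : ℝ)⁻¹) ^ 2 else 0) := by
  have h1 := sum_perm (n := n) (fun e => LexOrd 1 g e) (fun e => LexOrd τ (fun a => σ (g a)) e)
  have hA := count_perm (n := n) 1 g
  have hB := count_perm (n := n) τ (fun a => σ (g a))
  rw [fibProd_perm] at hB
  have hD : (n.descFactorial k : ℝ) ≠ 0 := by
    have := Nat.descFactorial_pos.2 hn
    positivity
  have hF : (fibProd g : ℝ) ≠ 0 := by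
    have := fibProd_pos g
    positivity
  set A := (univ.filter fun e : Fin k ↪ Fin n => LexOrd 1 g e).card
  set B := (univ.filter fun e : Fin k ↪ Fin n => LexOrd τ (fun a => σ (g a)) e).card
  set Sm := ∑ ρ : Equiv.Perm (Fin n), (univ.filter fun e : Fin k ↪ Fin n =>
        LexOrd 1 g e ∧ LexOrd τ (fun a => σ (g a)) (fun a => ρ (e a))).card with hSm
  have h1' : Sm * n.descFactorial k = n.factorial * (A * B) := h1
  have h2 : (Sm : ℝ) * n.descFactorial k = n.factorial * (A * B) := by exact_mod_cast h1'
  have hA' : (A : ℝ) * fibProd g = if (∀ a b, a ≤ b → g a ≤ g b) then (n.descFactorial k : ℝ) else 0 := by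
    by_cases c : ∀ a b, a ≤ b → g a ≤ g b
    · rw [if_pos c]; rw [if_pos (by simpa using c)] at hA; exact_mod_cast hA
    · rw [if_neg c]; rw [if_neg (by simpa using c)] at hA; exact_mod_cast hA
  have hB' : (B : ℝ) * fibProd g = if (∀ a b, τ a ≤ τ b → σ (g a) ≤ σ (g b)) then (n.descFactorial k : ℝ) else 0 := by
    have : ((B * fibProd g : ℕ) : ℝ) = _ := congrArg Nat.cast hB
    push_cast at this
    simpa using this
  apply mul_right_cancel₀ hD
  rw [h2]
  have hA2 := eq_div_of_mul_eq hF hA'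
  have hB2 := eq_div_of_mul_eq hF hB'
  rw [hA2, hB2]
  by_cases c1 : (∀ a b, a ≤ b → g a ≤ g b)
  · by_cases c2 : (∀ a b, τ a ≤ τ b → σ (g a) ≤ σ (g b))
    · have hG : Good σ τ g := ⟨c1, c2⟩
      rw [if_pos c1, if_pos c2, if_pos hG]; field_simp
    · have hG : ¬ Good σ τ g := fun h => c2 h.2
      rw [if_neg c2, if_neg hG]; simp
  · have hG : ¬ Good σ τ g := fun h => c1 h.1
    rw [if_neg c1, if_neg hG]; simp

open scoped Classical in
lemma avg_bounds {k m n : ℕ} (hn : k ≤ n) (σ : Equiv.Perm (Fin m)) (τ : Equiv.Perm (Fin k)) :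
    n.factorial * (n.descFactorial k * limS σ τ) ≤
      ∑ ρ : Equiv.Perm (Fin n), (patternCount (tensorPerm σ ρ) τ : ℝ) ∧
    ∑ ρ : Equiv.Perm (Fin n), (patternCount (tensorPerm σ ρ) τ : ℝ) ≤
      n.factorial * (n.descFactorial k * limS σ τ + m ^ k * (n ^ k - n.descFactorial k)) := by
  set F : (Fin k → Fin m) → Equiv.Perm (Fin n) → ℕ := fun g ρ =>
    (univ.filter fun e : Fin k ↪ Fin n =>
        LexOrd 1 g e ∧ LexOrd τ (fun a => σ (g a)) (fun a => ρ (e a))).card with hF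
  have key : ∑ ρ : Equiv.Perm (Fin n), ∑ g, (F g ρ : ℝ)
      = n.factorial * (n.descFactorial k * limS σ τ) := by
    rw [Finset.sum_comm]
    have : ∀ g, ∑ ρ : Equiv.Perm (Fin n), (F g ρ : ℝ) = n.factorial * n.descFactorial k *
        (if Good σ τ g then ((fibProd g : ℝ)⁻¹) ^ 2 else 0) := by
      intro g
      rw [← sum_emb hn σ τ g]; push_cast; rfl
    rw [Finset.sum_congr rfl (fun g _ => this g), ← Finset.mul_sum, ← Finset.sum_filter, mul_assoc]
    rfl
  have e : ∀ (ρ : Equiv.Perm (Fin n)) (g : Fin k → Fin m), _ := fun ρ g =>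
    emb_bounds (n := n) (fun h : Fin k → Fin n =>
        LexOrd 1 g h ∧ LexOrd τ (fun a => σ (g a)) (fun a => ρ (h a)))
  constructor
  · rw [← key]
    refine Finset.sum_le_sum fun ρ _ => ?_
    rw [pc_eq]; push_cast
    refine Finset.sum_le_sum fun g _ => ?_
    have h := (e ρ g).1
    rw [Nat.cast_le]
    convert h using 1 <;> (try simp only [hF]) <;> congr!
  · have : (n.factorial : ℝ) * (n.descFactorial k * limS σ τ + m ^ k * (n ^ k - n.descFactorial k))
        = ∑ ρ : Equiv.Perm (Fin n), ∑ g, ((F g ρ : ℝ) + (n ^ k - n.descFactorial k)) := by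
      simp only [Finset.sum_add_distrib, key]
      simp [Fintype.card_perm]; ring
    rw [this]
    refine Finset.sum_le_sum fun ρ _ => ?_
    rw [pc_eq]; push_cast
    refine Finset.sum_le_sum fun g _ => ?_
    have h : (univ.filter fun h : Fin k → Fin n =>
        LexOrd 1 g h ∧ LexOrd τ (fun a => σ (g a)) (fun a => ρ (h a))).card
         + n.descFactorial k ≤ F g ρ + n ^ k := by
      have h := (e ρ g).2
      convert h using 2 <;> (try simp only [hF]) <;> congr!
    have h' : ((univ.filter fun h : Fin k → Fin n =>
        LexOrd 1 g h ∧ LexOrd τ (fun a => σ (g a)) (fun a => ρ (h a))).card : ℝ)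
         + n.descFactorial k ≤ F g ρ + n ^ k := by exact_mod_cast h
    linarith

lemma rankPerm_lt {t : ℕ} (g : Fin t → ℕ) (hg : Function.Injective g) (i j : Fin t) :
    rankPerm g i < rankPerm g j ↔ g i < g j := by
  have e : ∀ i, rankPerm g i = rankFun g i := by
    intro i
    unfold rankPerm
    rw [dif_pos hg]
    rfl
  have key : ∀ i j : Fin t, g i < g j → rankPerm g i < rankPerm g j := by
    intro i j hlt
    rw [e, e, Fin.lt_def]
    refine Finset.card_lt_card (s := univ.filter fun x => g x < g i)
      (t := univ.filter fun x => g x < g j) ?_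
    refine ⟨fun x hx => ?_, fun hsub => ?_⟩
    · rcases Finset.mem_filter.mp hx with ⟨-, h2⟩
      exact Finset.mem_filter.mpr ⟨Finset.mem_univ x, lt_trans h2 hlt⟩
    · have := hsub (Finset.mem_filter.mpr ⟨Finset.mem_univ i, hlt⟩)
      exact lt_irrefl _ (Finset.mem_filter.mp this).2
  refine ⟨fun h => ?_, key i j⟩
  rcases lt_trichotomy (g i) (g j) with h1 | h1 | h1
  · exact h1
  · rw [hg h1] at h; exact absurd h (lt_irrefl _)
  · exact absurd (key j i h1) (lt_asymm h)

/-- For a surjective `c`, representatives computing `contract`. -/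
lemma contract_rep {k t : ℕ} (τ : Equiv.Perm (Fin k)) (c : Fin k → Fin t)
    (hc : ∀ j, ∃ i, c i = j) :
    ∃ r : Fin t → Fin k, (∀ j, c (r j) = j) ∧ (∀ i, τ (r (c i)) ≤ τ i) ∧
      ∀ i j, contract τ c i < contract τ c j ↔ τ (r i) < τ (r j) := by
  have hmem : ∀ j, ∃ i, c i = j ∧ (τ i : ℕ) = sInf {x : ℕ | ∃ i, c i = j ∧ (τ i : ℕ) = x} := by
    intro j
    have : {x : ℕ | ∃ i, c i = j ∧ (τ i : ℕ) = x}.Nonempty := by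
      obtain ⟨i, hi⟩ := hc j
      exact ⟨τ i, i, hi, rfl⟩
    exact Nat.sInf_mem this
  choose r hr1 hr2 using hmem
  refine ⟨r, hr1, ?_, ?_⟩
  · intro i
    rw [Fin.le_def, hr2]
    exact Nat.sInf_le ⟨i, rfl, rfl⟩
  · intro i j
    unfold contract
    rw [rankPerm_lt, ← hr2, ← hr2, Fin.lt_def]
    intro i j hij
    simp only [← hr2] at hij
    have := τ.injective (Fin.ext hij)
    rw [← hr1 i, ← hr1 j, this]

lemma good_comp {k m t : ℕ} (σ : Equiv.Perm (Fin m)) (τ : Equiv.Perm (Fin k))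
    (c : Fin k → Fin t) (hc : IsIntervalPartition τ c) (f : Fin t → Fin m)
    (hf : ∀ a b : Fin t, a < b → f a < f b)
    (hf2 : ∀ a b : Fin t, contract τ c a < contract τ c b ↔ σ (f a) < σ (f b)) :
    Good σ τ (fun a => f (c a)) := by
  obtain ⟨h1, h2, h3⟩ := hc
  obtain ⟨r, hr1, hr2, hr3⟩ := contract_rep τ c h2
  constructor
  · intro a b hab
    rcases (h1 a b hab).eq_or_lt with h | h
    · simp [h]
    · exact (hf _ _ h).le
  · intro a b hab
    by_contra hlt
    push Not at hlt
    have h4 := (hr3 _ _).1 ((hf2 _ _).2 hlt)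
    have hne : c a ≠ c b := by
      intro h; rw [h] at hlt; exact lt_irrefl _ hlt
    obtain ⟨i, hi1, hi2⟩ := h3 (r (c b)) b (τ a) (by rw [hr1]) (h4.le.trans (hr2 a)) hab
    rw [τ.injective hi2, hr1] at hi1
    exact hne hi1

lemma good_factor {k m t : ℕ} (σ : Equiv.Perm (Fin m)) (τ : Equiv.Perm (Fin k))
    (c : Fin k → Fin t) (hs : ∀ j, ∃ i, c i = j) (f : Fin t → Fin m) (hf : StrictMono f)
    (hg : Good σ τ (fun a => f (c a))) :
    IsIntervalPartition τ c ∧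
      ∀ a b : Fin t, contract τ c a < contract τ c b ↔ σ (f a) < σ (f b) := by
  obtain ⟨g1, g2⟩ := hg
  refine ⟨⟨fun a b hab => hf.le_iff_le.1 (g1 a b hab), hs, ?_⟩, ?_⟩
  · intro a b v hab h1 h2
    refine ⟨τ⁻¹ v, ?_, by simp⟩
    have e1 := g2 a (τ⁻¹ v) (by simpa using h1)
    have e2 := g2 (τ⁻¹ v) b (by simpa using h2)
    simp only [← hab] at e2
    exact (hf.injective (σ.injective (le_antisymm e1 e2))).symm
  · obtain ⟨r, hr1, hr2, hr3⟩ := contract_rep τ c hs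
    have key : ∀ a b, τ (r a) < τ (r b) → σ (f a) < σ (f b) := by
      intro a b hab
      have := g2 _ _ hab.le
      simp only [hr1] at this
      refine lt_of_le_of_ne this fun h => ?_
      have := hf.injective (σ.injective h)
      subst this
      exact lt_irrefl _ hab
    intro a b
    rw [hr3]
    refine ⟨key a b, fun h => ?_⟩
    rcases lt_trichotomy (τ (r a)) (τ (r b)) with h1 | h1 | h1
    · exact h1
    · have := τ.injective h1
      rw [← hr1 a, ← hr1 b, this] at h
      exact absurd h (lt_irrefl _)
    · exact absurd (key b a h1) (lt_asymm h)

lemma fibProd_comp {k m t : ℕ} (c : Fin k → Fin t) (f : Fin t → Fin m)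
    (hf : Function.Injective f) : fibProd (fun a => f (c a)) = fibProd c := by
  classical
  unfold fibProd
  symm
  rw [← Finset.prod_subset (Finset.subset_univ (univ.image f)), Finset.prod_image]
  · simp [hf.eq_iff]
  · intro a _ b _ h; exact hf h
  · intro j _ hj
    have : (univ.filter fun i => f (c i) = j) = ∅ := by
      rw [Finset.filter_eq_empty_iff]
      intro i _ h
      exact hj (by rw [← h]; simp)
    rw [this]; simp

open scoped Classical in
lemma sum_fixed_t {k m : ℕ} (t : ℕ) (σ : Equiv.Perm (Fin m)) (τ : Equiv.Perm (Fin k)) :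
    ∑ c ∈ univ.filter (fun c : Fin k → Fin t => IsIntervalPartition τ c),
          (patternCount σ (contract τ c) : ℝ) * ((fibProd c : ℝ)⁻¹) ^ 2
      = ∑ g ∈ (univ.filter (Good σ τ)).filter (fun g => (univ.image g).card = t),
          ((fibProd g : ℝ)⁻¹) ^ 2 := by
  have : ∀ c : Fin k → Fin t, (patternCount σ (contract τ c) : ℝ) * ((fibProd c : ℝ)⁻¹) ^ 2
      = ∑ f ∈ univ.filter (fun f : Fin t → Fin m => (∀ a b : Fin t, a < b → f a < f b) ∧
        (∀ a b : Fin t, contract τ c a < contract τ c b ↔ σ (f a) < σ (f b))),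
          ((fibProd c : ℝ)⁻¹) ^ 2 := by
    intro c
    rw [Finset.sum_const, nsmul_eq_mul]
    congr 2
  rw [Finset.sum_congr rfl (fun c _ => this c), Finset.sum_sigma']
  have hrange : ∀ (c : Fin k → Fin t) (f : Fin t → Fin m), (∀ j, ∃ i, c i = j) →
      univ.image (fun a => f (c a)) = univ.image f := by
    intro c f hc
    ext x
    simp only [mem_image, mem_univ, true_and]
    constructor
    · rintro ⟨a, rfl⟩; exact ⟨_, rfl⟩
    · rintro ⟨j, rfl⟩
      obtain ⟨i, rfl⟩ := hc j
      exact ⟨i, rfl⟩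
  refine Finset.sum_bij (fun p _ a => p.2 (p.1 a)) ?_ ?_ ?_ ?_
  · rintro ⟨c, f⟩ hp
    simp only [mem_sigma, mem_filter, mem_univ, true_and] at hp ⊢
    refine ⟨good_comp σ τ c hp.1 f hp.2.1 hp.2.2, ?_⟩
    have hm : StrictMono f := fun a b => hp.2.1 a b
    rw [hrange c f hp.1.2.1, Finset.card_image_of_injective _ hm.injective]
    simp
  · rintro ⟨c, f⟩ hp ⟨c', f'⟩ hp' hh
    simp only [mem_sigma, mem_filter, mem_univ, true_and] at hp hp' hh
    have hm : StrictMono f := fun a b => hp.2.1 a b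
    have hm' : StrictMono f' := fun a b => hp'.2.1 a b
    have hr : Set.range f = Set.range f' := by
      have h1 := hrange c f hp.1.2.1
      have h2 := hrange c' f' hp'.1.2.1
      rw [hh, h2] at h1
      have := congrArg (fun s : Finset (Fin m) => (s : Set (Fin m))) h1
      simpa using this.symm
    have : f = f' := (hm.range_inj hm').1 hr
    subst this
    have : c = c' := funext fun a => hm.injective (congrFun hh a)
    subst this
    rfl
  · intro g hg
    simp only [mem_filter, mem_univ, true_and] at hg
    obtain ⟨hg, hc⟩ := hg
    let f : Fin t → Fin m := fun j => (univ.image g).orderEmbOfFin hc j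
    have hm : StrictMono f := ((univ.image g).orderEmbOfFin hc).strictMono
    have hrg : Set.range f = ↑(univ.image g) := Finset.range_orderEmbOfFin _ hc
    have : ∀ a, ∃ j, f j = g a := by
      intro a
      have : g a ∈ Set.range f := by rw [hrg]; simp
      exact this
    choose c hcg using this
    have hg' : (fun a => f (c a)) = g := funext hcg
    have hs : ∀ j, ∃ i, c i = j := by
      intro j
      have : f j ∈ Set.range f := ⟨j, rfl⟩
      rw [hrg] at this
      simp only [coe_image, coe_univ, Set.image_univ, Set.mem_range] at this
      obtain ⟨i, hi⟩ := this
      exact ⟨i, hm.injective (by rw [hcg, hi])⟩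
    have := good_factor σ τ c hs f hm (by rw [hg']; exact hg)
    refine ⟨⟨c, f⟩, ?_, hg'⟩
    simp only [mem_sigma, mem_filter, mem_univ, true_and]
    exact ⟨this.1, fun a b h => hm h, this.2⟩
  · rintro ⟨c, f⟩ hp
    simp only [mem_sigma, mem_filter, mem_univ, true_and] at hp
    have hm : StrictMono f := fun a b => hp.2.1 a b
    simp only [fibProd_comp c f hm.injective]

open scoped Classical in
lemma rhs_eq {m k : ℕ} (hk : 1 ≤ k) (σ : Equiv.Perm (Fin m)) (τ : Equiv.Perm (Fin k)) :
      ∑ t ∈ Finset.Icc 1 k,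
        ∑ c ∈ Finset.univ.filter fun c : Fin k → Fin t => IsIntervalPartition τ c,
          (patternCount σ (contract τ c) : ℝ) *
            ∏ j : Fin t,
              ((Nat.factorial (Finset.univ.filter fun i => c i = j).card : ℝ)⁻¹) ^ 2
      = limS σ τ := by
  unfold limS
  rw [← Finset.sum_fiberwise_of_maps_to (s := univ.filter (Good σ τ)) (t := Icc 1 k)
    (g := fun g => (univ.image g).card)]
  · refine Finset.sum_congr rfl fun t _ => ?_
    rw [← sum_fixed_t]
    refine Finset.sum_congr rfl fun c _ => ?_
    congr 1
    unfold fibProd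
    rw [Finset.prod_pow, Finset.prod_inv_distrib]
    push_cast
    congr!
  · intro g _
    rw [mem_Icc]
    constructor
    · rw [Nat.one_le_iff_ne_zero, Finset.card_ne_zero]
      exact ⟨g ⟨0, hk⟩, by simp⟩
    · simpa using Finset.card_image_le (s := univ) (f := g)

open Filter Topology

lemma desc_lim (k : ℕ) :
    Tendsto (fun n : ℕ => (n.descFactorial k : ℝ) / (n : ℝ) ^ k) atTop (𝓝 1) := by
  induction k with
  | zero => simp
  | succ k ih =>
    have h1 : Tendsto (fun n : ℕ => 1 - (k : ℝ) / n) atTop (𝓝 (1 - 0)) :=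
      tendsto_const_nhds.sub (tendsto_const_div_atTop_nhds_zero_nat (k : ℝ))
    have h2 := ih.mul h1
    rw [sub_zero, mul_one] at h2
    refine h2.congr' ?_
    filter_upwards [eventually_ge_atTop (k + 1)] with n hn
    have hn0 : (n : ℝ) ≠ 0 := by
      have : 0 < n := by omega
      positivity
    rw [Nat.descFactorial_succ]
    push_cast [Nat.cast_sub (show k ≤ n by omega)]
    field_simp
    ring

open scoped Classical in
lemma avg_lim {k m : ℕ} (σ : Equiv.Perm (Fin m)) (τ : Equiv.Perm (Fin k)) :
    Tendsto (fun n : ℕ => (∑ ρ : Equiv.Perm (Fin n), (patternCount (tensorPerm σ ρ) τ : ℝ))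
      / (n.factorial : ℝ) / (n : ℝ) ^ k) atTop (𝓝 (limS σ τ)) := by
  have hd := desc_lim k
  have h1 : Tendsto (fun n : ℕ => (n.descFactorial k : ℝ) / (n : ℝ) ^ k * limS σ τ) atTop
      (𝓝 (limS σ τ)) := by simpa using hd.mul_const (limS σ τ)
  have h2 : Tendsto (fun n : ℕ => (n.descFactorial k : ℝ) / (n : ℝ) ^ k * limS σ τ
      + m ^ k * (1 - (n.descFactorial k : ℝ) / (n : ℝ) ^ k)) atTop
      (𝓝 (limS σ τ)) := by
    have := h1.add ((hd.const_sub 1).const_mul ((m : ℝ) ^ k))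
    simpa using this
  refine tendsto_of_tendsto_of_tendsto_of_le_of_le' h1 h2 ?_ ?_
  · filter_upwards [eventually_ge_atTop (k + 1)] with n hn
    have hn0 : (0 : ℝ) < n := by
      have : 0 < n := by omega
      positivity
    have hf : (0 : ℝ) < n.factorial := by exact_mod_cast n.factorial_pos
    have hb := (avg_bounds (n := n) (by omega) σ τ).1
    rw [le_div_iff₀ (by positivity), le_div_iff₀ (by positivity)]
    refine le_trans (le_of_eq ?_) hb
    field_simp
  · filter_upwards [eventually_ge_atTop (k + 1)] with n hn
    have hn0 : (0 : ℝ) < n := by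
      have : 0 < n := by omega
      positivity
    have hf : (0 : ℝ) < n.factorial := by exact_mod_cast n.factorial_pos
    have hb := (avg_bounds (n := n) (by omega) σ τ).2
    rw [div_le_iff₀ (by positivity), div_le_iff₀ (by positivity)]
    refine le_trans hb (le_of_eq ?_)
    field_simp

open scoped Classical in
/-- Bounded convergence in probability implies convergence of the mean. -/
lemma mean_lim (Y : ∀ n : ℕ, Equiv.Perm (Fin n) → ℝ) (C : ℝ)
    (hC : ∀ n ρ, |Y n ρ - 1| ≤ C)
    (hY : ∀ ε : ℝ, 0 < ε → Tendsto (fun n : ℕ =>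
      ((univ.filter fun ρ : Equiv.Perm (Fin n) => ε < |Y n ρ - 1|).card : ℝ) /
        (Fintype.card (Equiv.Perm (Fin n)) : ℝ)) atTop (𝓝 0)) :
    Tendsto (fun n : ℕ => (∑ ρ, Y n ρ) / (n.factorial : ℝ)) atTop (𝓝 1) := by
  have hC0 : 0 ≤ C := (abs_nonneg _).trans (hC 0 1)
  rw [Metric.tendsto_atTop']
  intro ε hε
  have h1 := hY (ε / 2) (by positivity)
  have h2 : Tendsto (fun n : ℕ => C * (((univ.filter fun ρ : Equiv.Perm (Fin n) =>
      ε / 2 < |Y n ρ - 1|).card : ℝ) / (Fintype.card (Equiv.Perm (Fin n)) : ℝ))) atTop (𝓝 0) := by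
    simpa using h1.const_mul C
  have h3 := h2.eventually (gt_mem_nhds (show (0 : ℝ) < ε / 2 by positivity))
  obtain ⟨N, hN⟩ := eventually_atTop.1 h3
  refine ⟨N, fun n hn => ?_⟩
  have h4 := hN n hn.le
  have hf : (0 : ℝ) < n.factorial := by exact_mod_cast n.factorial_pos
  have hcard : (Fintype.card (Equiv.Perm (Fin n)) : ℝ) = n.factorial := by
    rw [Fintype.card_perm]; simp
  rw [hcard] at h4
  rw [Real.dist_eq]
  have e1 : (∑ ρ, Y n ρ) / (n.factorial : ℝ) - 1 = (∑ ρ, (Y n ρ - 1)) / (n.factorial : ℝ) := by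
    rw [Finset.sum_sub_distrib]
    simp only [Finset.sum_const, Finset.card_univ, nsmul_eq_mul, mul_one, hcard]
    field_simp
  rw [e1, abs_div, abs_of_pos hf, div_lt_iff₀ hf]
  have e2 : |∑ ρ, (Y n ρ - 1)| ≤ ∑ ρ, (ε / 2 + C * (if ε / 2 < |Y n ρ - 1| then 1 else 0)) := by
    refine (Finset.abs_sum_le_sum_abs _ _).trans (Finset.sum_le_sum fun ρ _ => ?_)
    split_ifs with h
    · have := hC n ρ; linarith
    · push Not at h; linarith
  have e3 : ∑ ρ : Equiv.Perm (Fin n), (ε / 2 + C * (if ε / 2 < |Y n ρ - 1| then (1 : ℝ) else 0))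
      = n.factorial * (ε / 2) + C * (univ.filter fun ρ : Equiv.Perm (Fin n) =>
      ε / 2 < |Y n ρ - 1|).card := by
    rw [Finset.sum_add_distrib, ← Finset.mul_sum, Finset.sum_boole]
    simp only [Finset.sum_const, Finset.card_univ, nsmul_eq_mul, hcard]
  rw [e3] at e2
  rw [← mul_div_assoc, div_lt_iff₀ hf] at h4
  linarith

lemma pc_le {N k : ℕ} (π : Equiv.Perm (Fin N)) (τ : Equiv.Perm (Fin k)) :
    patternCount π τ ≤ N ^ k := by
  unfold patternCount
  refine (Finset.card_le_univ _).trans ?_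
  simp

end Infl

open scoped Classical in
theorem stmt17 {m k : ℕ} (hk : 1 ≤ k) (σ : Equiv.Perm (Fin m)) (h : IsKInflatable σ k)
    (τ : Equiv.Perm (Fin k)) :
    (m : ℝ) ^ k / (Nat.factorial k : ℝ) ^ 2 =
      ∑ t ∈ Finset.Icc 1 k,
        ∑ c ∈ Finset.univ.filter fun c : Fin k → Fin t => IsIntervalPartition τ c,
          (patternCount σ (contract τ c) : ℝ) *
            ∏ j : Fin t,
              ((Nat.factorial (Finset.univ.filter fun i => c i = j).card : ℝ)⁻¹) ^ 2 := by
  rw [Infl.rhs_eq hk]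
  obtain ⟨h1, h2⟩ := h
  have hm : m ≠ 0 := by
    rintro rfl
    have := h1.eventually (Filter.eventually_ge_atTop 1)
    obtain ⟨n, hn⟩ := this.exists
    omega
  have hm' : (0 : ℝ) < m := by positivity
  have hk' : (0 : ℝ) < k.factorial := by exact_mod_cast k.factorial_pos
  have hmean := Infl.mean_lim (fun n ρ => (Nat.factorial k : ℝ) ^ 2 *
      (patternCount (tensorPerm σ ρ) τ : ℝ) / ((m * n : ℕ) : ℝ) ^ k) ((Nat.factorial k : ℝ) ^ 2 + 1)
    (by
      intro n ρ
      have hle : (patternCount (tensorPerm σ ρ) τ : ℝ) ≤ ((m * n : ℕ) : ℝ) ^ k := by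
        exact_mod_cast Infl.pc_le (tensorPerm σ ρ) τ
      have h0 : (patternCount (tensorPerm σ ρ) τ : ℝ) / ((m * n : ℕ) : ℝ) ^ k ≤ 1 :=
        div_le_one_of_le₀ hle (by positivity)
      have h0' : 0 ≤ (patternCount (tensorPerm σ ρ) τ : ℝ) / ((m * n : ℕ) : ℝ) ^ k := by
        positivity
      rw [mul_div_assoc, abs_le]
      constructor <;> nlinarith [sq_nonneg (k.factorial : ℝ)])
    (h2 τ)
  have hlim := (Infl.avg_lim σ τ).const_mul ((Nat.factorial k : ℝ) ^ 2 / (m : ℝ) ^ k)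
  have := tendsto_nhds_unique (hmean.congr fun n => ?_) hlim
  · rw [div_mul_eq_mul_div, eq_div_iff (by positivity), one_mul] at this
    rw [this]
    field_simp
  · simp only [mul_div_assoc]
    rw [← Finset.mul_sum, ← Finset.sum_div]
    push_cast
    rw [mul_pow]
    field_simp
end
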